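/- arXiv:2503.21181 — 2 statements merged into one kernel-verified Lean document; each statement's English description precedes it below -/
import Mathlib

section
/- Let d ≥ 1, and let α ∈ ℝ^d be such that e^{i α·m} ≠ 1 for some m ∈ ℤ^d (equivalently α ∉ 2πℤ^d). Let u : ℝ^d → ℂ^d be twice continuously differentiable, α-quasi-periodic, and satisfy ∂u_i/∂x_j + ∂u_j/∂x_i = 0 on all of ℝ^d for every pair of indices i, j. Then u is identically zero. -/
open scoped BigOperators

/-- A differentiable field with vanishing linearized strain satisfies
`(u x - u y) · (x - y) = 0` for all `x, y`. -/
theorem sum_sub_mul_sub_eq_zero_of_zero_strain {ι : Type*} [Fintype ι] [DecidableEq ι]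
    {u : (ι → ℝ) → ι → ℂ} (hu : Differentiable ℝ u)
    (hstrain : ∀ (x : ι → ℝ) (i j : ι),
      fderiv ℝ (fun y => u y i) x (Pi.single j 1) +
        fderiv ℝ (fun y => u y j) x (Pi.single i 1) = 0) (x y : ι → ℝ) :
    ∑ i, (u x i - u y i) * ((x i - y i : ℝ) : ℂ) = 0 := by
  set v : ι → ℝ := x - y with hv
  have quadratic_zero (z : ι → ℝ) : ∑ i, fderiv ℝ (fun y => u y i) z v * (v i : ℂ) = 0 := by
    have expand (i : ι) : fderiv ℝ (fun y => u y i) z v =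
        ∑ j, (v j : ℂ) * fderiv ℝ (fun y => u y i) z (Pi.single j 1) := by
      conv_lhs => rw [pi_eq_sum_univ' v]
      simp [map_sum]
    have double : ∑ i, fderiv ℝ (fun y => u y i) z v * (v i : ℂ) =
        -∑ i, fderiv ℝ (fun y => u y i) z v * (v i : ℂ) := by
      simp only [expand, Finset.sum_mul, ← Finset.sum_neg_distrib]
      rw [Finset.sum_comm]
      refine Finset.sum_congr rfl fun i _ => Finset.sum_congr rfl fun j _ => ?_
      linear_combination (v i : ℂ) * (v j : ℂ) * hstrain z i j
    exact self_eq_neg.mp double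
  have deriv_zero (t : ℝ) :
      HasDerivAt (fun t : ℝ => ∑ i, u (y + t • v) i * (v i : ℂ)) 0 t := by
    rw [← quadratic_zero (y + t • v)]
    refine HasDerivAt.fun_sum fun i _ => HasDerivAt.mul_const ?_ _
    have line : HasDerivAt (fun t : ℝ => y + t • v) v t := by
      simpa using ((hasDerivAt_id t).smul_const v).const_add y
    exact (differentiable_pi.mp hu i _).hasFDerivAt.comp_hasDerivAt t line
  have endpoints := is_const_of_deriv_eq_zero (fun t => (deriv_zero t).differentiableAt)
    (fun t => (deriv_zero t).deriv) 1 0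
  have hx : y + v = x := by simp [hv]
  simp only [one_smul, zero_smul, add_zero, hx] at endpoints
  simpa [sub_mul, hv] using sub_eq_zero.mpr endpoints

/-- uniqueness claim in the proof of Lemma 3.6.
If `α ∈ ℝ^d` is such that `e^{i α·m} ≠ 1` for some `m ∈ ℤ^d`, and `u : ℝ^d → ℂ^d` is a twice
continuously differentiable `α`-quasi-periodic vector field whose linearized strain vanishes,
i.e. `∂u_i/∂x_j + ∂u_j/∂x_i = 0` everywhere for all `i, j`, then `u ≡ 0`. -/
theorem subwavelength_quasiperiodic_zero_strain_eq_zero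
    (d : ℕ) (hd : 1 ≤ d) (α : Fin d → ℝ)
    (hα : ∃ m : Fin d → ℤ, Complex.exp (Complex.I * ∑ j, (α j : ℂ) * (m j : ℂ)) ≠ 1)
    (u : (Fin d → ℝ) → (Fin d → ℂ))
    (hu : ContDiff ℝ 2 u)
    (hqp : ∀ (x : Fin d → ℝ) (n : Fin d → ℤ),
      u (x + fun j => (n j : ℝ)) = Complex.exp (Complex.I * ∑ j, (α j : ℂ) * (n j : ℂ)) • u x)
    (hstrain : ∀ (x : Fin d → ℝ) (i j : Fin d),
      fderiv ℝ (fun y => u y i) x (Pi.single j 1) +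
        fderiv ℝ (fun y => u y j) x (Pi.single i 1) = 0) :
    u = 0 := by
  classical
  have monotone_zero := sum_sub_mul_sub_eq_zero_of_zero_strain
    (hu.differentiable (by norm_num)) hstrain
  have norm_phase (n : Fin d → ℤ) :
      ‖Complex.exp (Complex.I * ∑ j, (α j : ℂ) * (n j : ℂ))‖ = 1 := by
    rw [mul_comm]
    exact_mod_cast Complex.norm_exp_ofReal_mul_I (∑ j, α j * (n j : ℝ))
  have const (x y : Fin d → ℝ) : u x = u y := by
    ext i
    set C : ℝ := ∑ j, (‖u x j‖ + ‖u y j‖) * ‖((x j - y j : ℝ) : ℂ)‖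
    have bound (k : ℕ) : (k : ℝ) * ‖u x i - u y i‖ ≤ C := by
      set n : Fin d → ℤ := Pi.single i (k : ℤ) with hn
      set w := Complex.exp (Complex.I * ∑ j, (α j : ℂ) * (n j : ℂ)) with hw
      have hw1 : ‖w‖ = 1 := norm_phase n
      have shifted (z : Fin d → ℝ) :
          ∑ j, (w * u z j - u y j) * ((z j - y j : ℝ) : ℂ) + (w * u z i - u y i) * k = 0 := by
        have h := monotone_zero (z + fun j => (n j : ℝ)) y
        rw [hqp z n, ← hw] at h
        have hk : ∑ j, (w * u z j - u y j) * (n j : ℂ) = (w * u z i - u y i) * k := by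
          rw [Finset.sum_eq_single i] <;> simp +contextual [hn]
        rw [← hk, ← Finset.sum_add_distrib, ← h]
        refine Finset.sum_congr rfl fun j _ => ?_
        simp only [Pi.add_apply, Pi.smul_apply, smul_eq_mul]
        push_cast
        ring
      have hy := shifted y
      simp only [sub_self, Complex.ofReal_zero, mul_zero, Finset.sum_const_zero, zero_add] at hy
      have key : (k : ℂ) * (w * (u x i - u y i)) =
          -∑ j, (w * u x j - u y j) * ((x j - y j : ℝ) : ℂ) := by
        linear_combination shifted x - hy
      calc (k : ℝ) * ‖u x i - u y i‖ = ‖(k : ℂ) * (w * (u x i - u y i))‖ := by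
            simp [hw1]
        _ ≤ C := by
            rw [key, norm_neg]
            refine norm_sum_le_of_le _ fun j _ => ?_
            rw [norm_mul]
            gcongr
            simpa [hw1] using norm_sub_le (w * u x j) (u y j)
    by_contra hne
    obtain ⟨k, hk⟩ := exists_nat_gt (C / ‖u x i - u y i‖)
    rw [div_lt_iff₀ (norm_pos_iff.mpr (sub_ne_zero.mpr hne))] at hk
    exact (bound k).not_gt hk
  obtain ⟨m, hm⟩ := hα
  funext x
  have h := hqp x m
  rw [const _ x] at h
  refine (smul_eq_zero.mp (?_ : (Complex.exp (Complex.I * ∑ j, (α j : ℂ) * (m j : ℂ)) - 1) •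
    u x = 0)).resolve_left (sub_ne_zero.mpr hm)
  rw [sub_smul, one_smul, ← h, sub_self]
end

section
/- Let V be a complex vector space, d a positive integer, and a : V × V → ℂ a sesquilinear form (additive and ℂ-linear in its first argument, additive and conjugate-linear in its second argument). Assume a is nondegenerate in its first argument: if u ∈ V satisfies a(u, v) = 0 for all v ∈ V, then u = 0. Let φ₁, …, φ_d : V → ℂ be ℂ-linear maps, and suppose w₁, …, w_d ∈ V satisfy a(w_i, v) = conj(φ_i(v)) for all v ∈ V and all i. Define the complex d×d matrix P by P_ij = φ_i(w_j). Then there exists u ∈ V with u ≠ 0 such that a(u, v) = Σ_{i=1}^d φ_i(u) · conj(φ_i(v)) for all v ∈ V, if and only if det(I − P) = 0, where I is the d×d identity matrix. Moreover, any such u satisfies u = Σ_{j=1}^d h_j w_j, where the vector h = (φ_i(u))_{i=1}^d ∈ ℂ^d is nonzero and satisfies (I − P) h = 0. -/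
open scoped BigOperators Matrix

/-- A form additive and homogeneous in its first argument commutes with finite linear
combinations there. -/
theorem form_sum_smul_left {ι R V : Type*} [Fintype ι] [Ring R] [AddCommGroup V] [Module R V]
    (a : V → V → R) (hadd : ∀ u u' v, a (u + u') v = a u v + a u' v)
    (hsmul : ∀ (c : R) (u v : V), a (c • u) v = c * a u v)
    (c : ι → R) (w : ι → V) (v : V) :
    a (∑ j, c j • w j) v = ∑ j, c j * a (w j) v := by
  let f : V →ₗ[R] R :=
    { toFun := fun u => a u v
      map_add' := fun u u' => hadd u u' v
      map_smul' := fun r u => hsmul r u v }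
  change f (∑ j, c j • w j) = ∑ j, c j * f (w j)
  simp

/-- The coordinates of a linear combination of the `w j` under the functionals `φ i` are given
by the matrix `P i j = φ i (w j)`. -/
theorem map_sum_smul_eq_mulVec {ι R V : Type*} [Fintype ι] [CommRing R] [AddCommGroup V]
    [Module R V] (φ : ι → V →ₗ[R] R) (w : ι → V) (P : Matrix ι ι R)
    (hP : ∀ i j, P i j = φ i (w j)) (c : ι → R) (i : ι) :
    φ i (∑ j, c j • w j) = (P *ᵥ c) i := by
  simp [Matrix.mulVec, dotProduct, hP, mul_comm]

/-- abstract form of Proposition 3.7: characterization of subwavelength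
resonances.  Let `a : V × V → ℂ` be a sesquilinear form (linear in the first argument,
conjugate-linear in the second) which is nondegenerate in its first argument, let
`φ₁, …, φ_d : V → ℂ` be linear functionals, and let `w_i ∈ V` satisfy
`a(w_i, v) = conj(φ_i v)` for all `v`.  With `P_ij = φ_i(w_j)`, there exists a nonzero `u` with
`a(u, v) = Σ_i φ_i(u) conj(φ_i(v))` for all `v` iff `det(I − P) = 0`; moreover any such `u`
equals `Σ_j φ_j(u) • w_j` and the vector `h = (φ_i(u))_i` is nonzero with `(I − P) h = 0`. -/
theorem subwavelength_resonance_characterization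
    (V : Type*) [AddCommGroup V] [Module ℂ V] (d : ℕ) (hd : 1 ≤ d)
    (a : V → V → ℂ)
    (ha_add₁ : ∀ u u' v, a (u + u') v = a u v + a u' v)
    (ha_smul₁ : ∀ (c : ℂ) (u v : V), a (c • u) v = c * a u v)
    (ha_add₂ : ∀ u v v', a u (v + v') = a u v + a u v')
    (ha_smul₂ : ∀ (c : ℂ) (u v : V), a u (c • v) = starRingEnd ℂ c * a u v)
    (ha_nondeg : ∀ u : V, (∀ v : V, a u v = 0) → u = 0)
    (φ : Fin d → V →ₗ[ℂ] ℂ) (w : Fin d → V)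
    (hw : ∀ (i : Fin d) (v : V), a (w i) v = starRingEnd ℂ (φ i v))
    (P : Matrix (Fin d) (Fin d) ℂ) (hP : ∀ i j, P i j = φ i (w j)) :
    ((∃ u : V, u ≠ 0 ∧ ∀ v : V, a u v = ∑ i, φ i u * starRingEnd ℂ (φ i v)) ↔
        (1 - P).det = 0)
    ∧ ∀ u : V, u ≠ 0 → (∀ v : V, a u v = ∑ i, φ i u * starRingEnd ℂ (φ i v)) →
        u = ∑ j, φ j u • w j
          ∧ (fun i => φ i u) ≠ (0 : Fin d → ℂ)
          ∧ (1 - P) *ᵥ (fun i => φ i u) = 0 := by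
  have hform (c : Fin d → ℂ) (v : V) :
      a (∑ j, c j • w j) v = ∑ j, c j * starRingEnd ℂ (φ j v) := by
    simp only [form_sum_smul_left a ha_add₁ ha_smul₁, hw]
  have hmode : ∀ u : V, u ≠ 0 → (∀ v : V, a u v = ∑ i, φ i u * starRingEnd ℂ (φ i v)) →
      u = ∑ j, φ j u • w j
        ∧ (fun i => φ i u) ≠ (0 : Fin d → ℂ)
        ∧ (1 - P) *ᵥ (fun i => φ i u) = 0 := by
    intro u hu h
    have hu_eq : u = ∑ j, φ j u • w j := by
      refine sub_eq_zero.mp (ha_nondeg _ fun v => ?_)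
      rw [sub_eq_add_neg, ← neg_one_smul ℂ, ha_add₁, ha_smul₁, h, hform (fun j => φ j u)]
      ring
    refine ⟨hu_eq, fun h0 => hu ?_, ?_⟩
    · rw [hu_eq]
      exact Finset.sum_eq_zero fun j _ => by rw [show φ j u = 0 from congrFun h0 j, zero_smul]
    · rw [Matrix.sub_mulVec, Matrix.one_mulVec, sub_eq_zero]
      funext i
      rw [← map_sum_smul_eq_mulVec φ w P hP, ← hu_eq]
  refine ⟨⟨?_, fun hdet => ?_⟩, hmode⟩
  · rintro ⟨u, hu, h⟩
    exact Matrix.exists_mulVec_eq_zero_iff.mp ⟨_, (hmode u hu h).2⟩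
  · obtain ⟨c, hc, hPc⟩ := Matrix.exists_mulVec_eq_zero_iff.mpr hdet
    rw [Matrix.sub_mulVec, Matrix.one_mulVec, sub_eq_zero] at hPc
    have hφ (i : Fin d) : φ i (∑ j, c j • w j) = c i := by
      rw [map_sum_smul_eq_mulVec φ w P hP, ← hPc]
    refine ⟨∑ j, c j • w j, fun h0 => hc ?_, fun v => ?_⟩
    · funext i
      rw [← hφ i, h0, map_zero, Pi.zero_apply]
    · simp only [hform, hφ]
end
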